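/- Let n, m, d be positive integers and let g_1, …, g_m be convex polynomials on ℝ^n, each of degree at most d. Let S := {x ∈ ℝ^n : g_i(x) ≤ 0 for all i = 1, …, m} and let x̄ ∈ S. Define J_0 := {i ∈ {1, …, m} : g_i(x) = 0 for all x ∈ S} and J_1 := {1, …, m} \ J_0, and set τ := max{2/κ(n, 2d), 1/(β(n−1)·d^n)}. Then there exist constants c > 0 and ε > 0 such that for all x ∈ ℝ^n with ‖x − x̄‖ ≤ ε, dist(x, S) ≤ c·( max_{i ∈ J_1} [g_i(x)]_+ + ( max_{i ∈ J_0} [g_i(x)]_+ )^τ ), where a maximum over an empty index set is taken to be 0. -/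

import Mathlib

open Metric Set Filter
open scoped BigOperators

noncomputable section

/-- A polynomial of degree at most `d` is controlled on `[1, ∞)` by its values at `0, …, d`. -/
lemma Polynomial.exists_abs_eval_le_mul_pow (d : ℕ) :
    ∃ K > (0 : ℝ), ∀ p : Polynomial ℝ, p.natDegree ≤ d → ∀ X : ℝ, 1 ≤ X → ∀ B : ℝ,
      (∀ j ∈ Finset.range (d + 1), |p.eval (j : ℝ)| ≤ B) → |p.eval X| ≤ K * B * X ^ d := by
  have growth : ∀ P : Polynomial ℝ, P.natDegree ≤ d → ∀ X : ℝ, 1 ≤ X →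
      |P.eval X| ≤ (∑ i ∈ Finset.range (d + 1), |P.coeff i|) * X ^ d := by
    intro P hP X hX
    rw [Polynomial.eval_eq_sum_range' (Nat.lt_succ_of_le hP), Finset.sum_mul]
    refine (Finset.abs_sum_le_sum_abs _ _).trans (Finset.sum_le_sum fun i hi => ?_)
    rw [abs_mul, abs_of_nonneg (by positivity : (0 : ℝ) ≤ X ^ i)]
    have : i ≤ d := by simpa [Nat.lt_succ_iff] using hi
    gcongr
  have hinj : Set.InjOn (fun j : ℕ => (j : ℝ)) (Finset.range (d + 1)) :=
    fun _ _ _ _ h => Nat.cast_injective (R := ℝ) h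
  let L : ℕ → Polynomial ℝ := Lagrange.basis (Finset.range (d + 1)) (fun j : ℕ => (j : ℝ))
  let K : ℝ := ∑ j ∈ Finset.range (d + 1), ∑ i ∈ Finset.range (d + 1), |(L j).coeff i|
  have hK : 0 ≤ K := Finset.sum_nonneg fun _ _ => Finset.sum_nonneg fun _ _ => abs_nonneg _
  refine ⟨K + 1, by linarith, fun p hp X hX B hB => ?_⟩
  have hB0 : 0 ≤ B := (abs_nonneg _).trans (hB 0 (by simp))
  have hpe : p = Lagrange.interpolate (Finset.range (d + 1)) (fun j : ℕ => (j : ℝ))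
      (fun j => p.eval (j : ℝ)) := by
    refine Lagrange.eq_interpolate hinj ?_
    rw [Finset.card_range]
    exact lt_of_le_of_lt Polynomial.degree_le_natDegree (by exact_mod_cast Nat.lt_succ_of_le hp)
  have key : |p.eval X| ≤ K * B * X ^ d := by
    conv_lhs => rw [hpe, Lagrange.interpolate_apply, Polynomial.eval_finsetSum]
    refine (Finset.abs_sum_le_sum_abs _ _).trans ?_
    rw [Finset.sum_mul, Finset.sum_mul]
    refine Finset.sum_le_sum fun j hj => ?_
    rw [Polynomial.eval_mul, Polynomial.eval_C, abs_mul]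
    have hdeg : (L j).natDegree ≤ d := by
      rw [Lagrange.natDegree_basis hinj hj]; simp
    calc _ ≤ B * ((∑ i ∈ Finset.range (d + 1), |(L j).coeff i|) * X ^ d) :=
          mul_le_mul (hB j hj) (growth (L j) hdeg X hX) (abs_nonneg _) hB0
      _ = _ := by ring
  have : 0 ≤ B * X ^ d := by positivity
  nlinarith

/-- The restriction of `g` to each line through the origin is a polynomial of degree at most `d`. -/
def IsPolynomialOnRays {E : Type*} [AddCommGroup E] [Module ℝ E] (d : ℕ) (g : E → ℝ) : Prop :=
  ∀ v : E, ∃ p : Polynomial ℝ, p.natDegree ≤ d ∧ ∀ t : ℝ, g (t • v) = p.eval t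

lemma IsPolynomialOnRays.sum_mul {E κ : Type*} [AddCommGroup E] [Module ℝ E] [Fintype κ] {d : ℕ}
    {g : κ → E → ℝ} (hg : ∀ i, IsPolynomialOnRays d (g i)) (w : κ → ℝ) :
    IsPolynomialOnRays d (fun x => ∑ i, w i * g i x) := by
  intro v
  choose p hp hpe using fun i => hg i v
  refine ⟨∑ i, Polynomial.C (w i) * p i, ?_, fun t => ?_⟩
  · refine Polynomial.natDegree_sum_le_of_forall_le _ _ fun i _ => ?_
    exact (Polynomial.natDegree_C_mul_le _ _).trans (hp i)
  · simp [Polynomial.eval_finsetSum, hpe]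

lemma ConvexOn.sum_mul {E κ : Type*} [AddCommGroup E] [Module ℝ E] [Fintype κ]
    {g : κ → E → ℝ} (hg : ∀ i, ConvexOn ℝ Set.univ (g i)) {w : κ → ℝ} (hw : ∀ i, 0 ≤ w i) :
    ConvexOn ℝ Set.univ (fun x => ∑ i, w i * g i x) := by
  refine ⟨convex_univ, fun x _ y _ a b ha hb hab => ?_⟩
  simp only [smul_eq_mul, Finset.mul_sum]
  rw [← Finset.sum_add_distrib]
  refine Finset.sum_le_sum fun i _ => ?_
  have := mul_le_mul_of_nonneg_left ((hg i).2 (Set.mem_univ x) (Set.mem_univ y) ha hb hab) (hw i)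
  simp only [smul_eq_mul] at this
  linarith

lemma ConvexOn.map_smul_le_of_map_zero {E : Type*} [AddCommGroup E] [Module ℝ E] {g : E → ℝ}
    (hg : ConvexOn ℝ Set.univ g) (h0 : g 0 = 0) {a : ℝ} (ha : 0 ≤ a) (ha1 : a ≤ 1) (x : E) :
    g (a • x) ≤ a * g x := by
  have := hg.2 (Set.mem_univ x) (Set.mem_univ 0) ha (sub_nonneg.2 ha1) (by ring)
  simpa [h0] using this

lemma ConvexOn.map_add_le_of_two_smul {E : Type*} [AddCommGroup E] [Module ℝ E] {g : E → ℝ}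
    (hg : ConvexOn ℝ Set.univ g) (x y : E) :
    g (x + y) ≤ (g ((2 : ℝ) • x) + g ((2 : ℝ) • y)) / 2 := by
  have := hg.2 (Set.mem_univ ((2 : ℝ) • x)) (Set.mem_univ ((2 : ℝ) • y)) 
    (by norm_num : (0 : ℝ) ≤ 1 / 2) (by norm_num : (0 : ℝ) ≤ 1 / 2) (by norm_num)
  simp only [smul_smul, smul_eq_mul] at this
  norm_num at this
  linarith

/-- A convex function which is a polynomial of degree at most `d` on rays and nonnegative with
minimum `0` at the origin grows at least like `t ^ d` along rays. -/
lemma exists_pow_mul_le_of_convexOn_of_isPolynomialOnRays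
    (E : Type*) [AddCommGroup E] [Module ℝ E] (d : ℕ) :
    ∃ K > (0 : ℝ), ∀ {g : E → ℝ},
      ConvexOn ℝ Set.univ g → IsPolynomialOnRays d g → g 0 = 0 → ∀ x : E, (∀ t : ℝ, 0 ≤ g (t • x)) →
      ∀ t : ℝ, 0 < t → t ≤ 1 → t ^ d * g x ≤ K * g (t • x) := by
  obtain ⟨K, hK, hgrow⟩ := Polynomial.exists_abs_eval_le_mul_pow d
  refine ⟨K * (d + 1) ^ d, by positivity, ?_⟩
  intro g hc hp h0 x hx t ht ht1
  have hd : (0 : ℝ) < d + 1 := by positivity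
  obtain ⟨p, hpd, hpe⟩ := hp ((t / (d + 1)) • x)
  have hX : 1 ≤ (d + 1) / t := by
    rw [le_div_iff₀ ht]; have : (0 : ℝ) ≤ d := by positivity
    linarith
  have hval : ∀ j ∈ Finset.range (d + 1), |p.eval (j : ℝ)| ≤ g (t • x) := by
    intro j hj
    have hj' : (j : ℝ) ≤ d + 1 := by exact_mod_cast (Finset.mem_range.1 hj).le
    rw [← hpe, smul_smul, abs_of_nonneg (hx _)]
    have e : ((j : ℝ) * (t / (d + 1))) • x = ((j : ℝ) / (d + 1)) • t • x := by
      rw [smul_smul]; congr 1; ring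
    have hj1 : (j : ℝ) / (d + 1) ≤ 1 := by rw [div_le_one hd]; exact hj'
    rw [e]
    refine (hc.map_smul_le_of_map_zero h0 (by positivity) hj1 _).trans ?_
    have := hx t
    nlinarith
  have := hgrow p hpd _ hX _ hval
  rw [← hpe, smul_smul] at this
  have e1 : (d + 1 : ℝ) / t * (t / (d + 1)) = 1 := by field_simp
  rw [e1, one_smul, div_pow] at this
  have := (le_abs_self _).trans this
  calc t ^ d * g x ≤ t ^ d * (K * g (t • x) * ((d + 1) ^ d / t ^ d)) := by gcongr
    _ = _ := by field_simp

/-- Theorem of the alternative for finitely many convex functions: if at each point of a subspace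
one of them is nonnegative, so is a nontrivial nonnegative combination. -/
lemma exists_nonneg_combination_of_forall_exists_nonneg {E κ : Type*} [AddCommGroup E] [Module ℝ E]
    [Fintype κ] [Nonempty κ] {g : κ → E → ℝ} (hg : ∀ i, ConvexOn ℝ Set.univ (g i))
    (W : Submodule ℝ E) (h : ∀ x ∈ W, ∃ i, 0 ≤ g i x) :
    ∃ w : κ → ℝ, (∀ i, 0 ≤ w i) ∧ (∃ i, 0 < w i) ∧ ∀ x ∈ W, 0 ≤ ∑ i, w i * g i x := by
  classical
  let s : Set (κ → ℝ) := {v | ∀ i, v i < 0}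
  let t : Set (κ → ℝ) := {v | ∃ x ∈ W, ∀ i, g i x ≤ v i}
  have hs : Convex ℝ s := by
    have : s = Set.pi Set.univ fun _ => Iio 0 := by ext; simp [s]
    rw [this]; exact convex_pi fun _ _ => convex_Iio 0
  have hso : IsOpen s := by
    have : s = Set.pi Set.univ fun _ => Iio 0 := by ext; simp [s]
    rw [this]; exact isOpen_set_pi finite_univ fun _ _ => isOpen_Iio
  have ht : Convex ℝ t := by
    rintro u ⟨x, hx, hxu⟩ v ⟨y, hy, hyv⟩ a b ha hb hab
    refine ⟨a • x + b • y, W.add_mem (W.smul_mem _ hx) (W.smul_mem _ hy), fun i => ?_⟩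
    refine ((hg i).2 (Set.mem_univ x) (Set.mem_univ y) ha hb hab).trans ?_
    simp only [smul_eq_mul, Pi.add_apply, Pi.smul_apply]
    have := hxu i
    have := hyv i
    gcongr
  have hd : Disjoint s t := by
    rw [Set.disjoint_left]
    rintro v hv ⟨x, hx, hxv⟩
    obtain ⟨i, hi⟩ := h x hx
    exact absurd (hi.trans (hxv i)) (not_le.2 (hv i))
  obtain ⟨f, u, hfs, hft⟩ := geometric_hahn_banach_open hs hso ht hd
  have hf : ∀ v, f v = ∑ i, f (Pi.single i 1) * v i := by
    intro v
    conv_lhs => rw [pi_eq_sum_univ' v, map_sum]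
    refine Finset.sum_congr rfl fun i _ => ?_
    rw [map_smul, smul_eq_mul, mul_comm]
  have hneg : ∀ ε : ℝ, 0 < ε → -ε * f 1 < u := by
    intro ε hε
    have := hfs (-ε • 1) (fun i => by simpa using hε)
    simpa using this
  have hu : 0 ≤ u := by
    by_contra! hu
    by_cases h1 : f 1 ≤ 0
    · have := hneg 1 one_pos
      linarith
    · push Not at h1
      have := hneg (-u / (2 * f 1)) (by apply div_pos <;> linarith)
      have e : -(-u / (2 * f 1)) * f 1 = u / 2 := by field_simp
      linarith
  have hw : ∀ i, 0 ≤ f (Pi.single i 1) := by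
    intro i
    by_contra! hi
    set c := f (Pi.single i 1)
    have key : ∀ N : ℝ, 0 ≤ N → u ≤ f (fun j => g j 0) + N * c := by
      intro N hN
      have := hft ((fun j => g j 0) + N • Pi.single i 1) ⟨0, W.zero_mem, fun j => by
        simp only [Pi.add_apply, Pi.smul_apply, smul_eq_mul, Pi.single_apply]
        split_ifs <;> simp [hN]⟩
      simpa [c] using this
    have h1 := key ((|f (fun j => g j 0)| + 1) / -c) (by apply div_nonneg; positivity; linarith)
    have e : (|f (fun j => g j 0)| + 1) / -c * c = -(|f (fun j => g j 0)| + 1) := by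
      have := hi.ne
      field_simp
    have := le_abs_self (f (fun j => g j 0))
    linarith
  refine ⟨fun i => f (Pi.single i 1), hw, ?_, fun x hx => ?_⟩
  · by_contra! hcon
    have hz : ∀ v, f v = 0 := fun v => by
      rw [hf]
      exact Finset.sum_eq_zero fun i _ => by rw [le_antisymm (hcon i) (hw i), zero_mul]
    have h1 := hfs (fun _ => -1) (fun _ => by norm_num)
    have h2 := hft (fun i => g i 0) ⟨0, W.zero_mem, fun _ => le_rfl⟩
    rw [hz] at h1 h2
    linarith
  · have := hft (fun i => g i x) ⟨x, hx, fun _ => le_rfl⟩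
    rw [hf] at this
    linarith


section

variable {E : Type*} [NormedAddCommGroup E] [InnerProductSpace ℝ E] [FiniteDimensional ℝ E]

lemma exists_forall_map_sub_le {ι : Type*} {g : ι → E → ℝ}
    (hg : ∀ i, ConvexOn ℝ Set.univ (g i)) (I : Finset ι) (R : ℝ) :
    ∃ L ≥ (0 : ℝ), ∀ i ∈ I, ∀ x y : E, ‖x‖ ≤ R → ‖x - y‖ ≤ R → g i (x - y) ≤ g i x + L * ‖y‖ := by
  have hlip : ∀ i, ∃ K : NNReal, LipschitzOnWith K (g i) (closedBall 0 R) := fun i =>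
    LocallyLipschitzOn.exists_lipschitzOnWith_of_compact (isCompact_closedBall _ _)
      (hg i).locallyLipschitz.locallyLipschitzOn
  choose K hK using hlip
  refine ⟨∑ i ∈ I, (K i : ℝ), Finset.sum_nonneg fun _ _ => NNReal.coe_nonneg _, ?_⟩
  intro i hi x y hx hxy
  have h1 := (hK i).dist_le_mul (x - y) (by simpa using hxy) x (by simpa using hx)
  rw [Real.dist_eq, dist_eq_norm, sub_sub_cancel_left, norm_neg] at h1
  have h2 : (K i : ℝ) ≤ ∑ i ∈ I, (K i : ℝ) :=
    Finset.single_le_sum (f := fun i => (K i : ℝ)) (fun _ _ => NNReal.coe_nonneg _) hi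
  have h3 := le_abs_self (g i (x - y) - g i x)
  have h4 := mul_le_mul_of_nonneg_right h2 (norm_nonneg y)
  linarith


/-- Composition of a Hölder estimate for the distance to `Z` with a Hölder estimate inside `Z`. -/
lemma exists_holder_bound_of_correction {ι : Type*} {g : ι → E → ℝ}
    (hg : ∀ i, ConvexOn ℝ Set.univ (g i)) {W Z : Submodule ℝ E} {I I' : Finset ι} (hI : I' ⊆ I)
    {N N' e : ℕ} (hN' : N' ≠ 0) (hN : e * N' ≤ N) (hN'N : N' ≤ N) {P : E → Prop} (hP : P 0)
    (hcorr : ∀ R : ℝ, ∃ C ≥ (0 : ℝ), ∀ x ∈ W, ‖x‖ ≤ R → ∀ s ≥ (0 : ℝ),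
      (∀ i ∈ I, g i x ≤ s ^ e) → ∃ y, x - y ∈ Z ∧ ‖y‖ ≤ C * s)
    (hZ : ∀ R : ℝ, ∃ C ≥ (0 : ℝ), ∀ x ∈ Z, ‖x‖ ≤ R → ∀ s ≥ (0 : ℝ),
      (∀ i ∈ I', g i x ≤ s ^ N') → ∃ y, P y ∧ ‖x - y‖ ≤ C * s) (R : ℝ) :
    ∃ C ≥ (0 : ℝ), ∀ x ∈ W, ‖x‖ ≤ R → ∀ s ≥ (0 : ℝ),
      (∀ i ∈ I, g i x ≤ s ^ N) → ∃ y, P y ∧ ‖x - y‖ ≤ C * s := by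
  obtain ⟨C₁, hC₁, h₁⟩ := hcorr R
  obtain ⟨C₂, hC₂, h₂⟩ := hZ (R + C₁)
  obtain ⟨L, hL, hLip⟩ := exists_forall_map_sub_le hg I (R + C₁)
  refine ⟨|R| + (C₁ + C₂ * (1 + L * C₁)), by positivity, fun x hx hxR s hs hgx => ?_⟩
  rcases le_total 1 s with hs1 | hs1
  · refine ⟨0, hP, ?_⟩
    rw [sub_zero]
    have : 0 ≤ (C₁ + C₂ * (1 + L * C₁)) * s := by positivity
    nlinarith [le_abs_self R, abs_nonneg R]
  have hsN' : s ^ N' ≤ s := pow_le_of_le_one hs hs1 hN'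
  obtain ⟨y, hyZ, hy⟩ := h₁ x hx hxR (s ^ N') (by positivity) fun i hi =>
    (hgx i hi).trans (by
      rw [← pow_mul, mul_comm]
      exact pow_le_pow_of_le_one hs hs1 hN)
  have hyC : ‖y‖ ≤ C₁ := hy.trans (by nlinarith)
  have hxyR : ‖x - y‖ ≤ R + C₁ := (norm_sub_le _ _).trans (by linarith)
  obtain ⟨z, hz, hxz⟩ := h₂ (x - y) hyZ hxyR ((1 + L * C₁) * s) (by positivity) fun i hi => by
    have hLC : 1 ≤ 1 + L * C₁ := by nlinarith
    calc g i (x - y) ≤ g i x + L * ‖y‖ := hLip i (hI hi) x y (by linarith) hxyR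
      _ ≤ s ^ N' + L * (C₁ * s ^ N') := by
          gcongr
          exact (hgx i (hI hi)).trans (pow_le_pow_of_le_one hs hs1 hN'N)
      _ = (1 + L * C₁) * s ^ N' := by ring
      _ ≤ (1 + L * C₁) ^ N' * s ^ N' := by
          gcongr
          exact le_self_pow₀ hLC hN'
      _ = _ := (mul_pow _ _ _).symm
  refine ⟨z, hz, ?_⟩
  have e1 : x - z = y + (x - y - z) := by abel
  calc ‖x - z‖ ≤ ‖y‖ + ‖x - y - z‖ := by rw [e1]; exact norm_add_le _ _
    _ ≤ C₁ * s + C₂ * ((1 + L * C₁) * s) := by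
        refine add_le_add (hy.trans ?_) hxz
        gcongr
    _ ≤ _ := by nlinarith [abs_nonneg R, mul_nonneg (abs_nonneg R) hs]

/-- A function which is affine on segments of a subspace and vanishes at `0` is linear there. -/
lemma map_add_and_map_smul_of_affine_on_segments {V : Type*} [AddCommGroup V] [Module ℝ V]
    {f : V → ℝ} {W : Submodule ℝ V} (h0 : f 0 = 0)
    (hf : ∀ x ∈ W, ∀ y ∈ W, ∀ a b : ℝ, 0 ≤ a → 0 ≤ b → a + b = 1 →
      f (a • x + b • y) = a * f x + b * f y) :
    (∀ x ∈ W, ∀ y ∈ W, f (x + y) = f x + f y) ∧ ∀ x ∈ W, ∀ a : ℝ, f (a • x) = a * f x := by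
  have hle : ∀ x ∈ W, ∀ a : ℝ, 0 ≤ a → a ≤ 1 → f (a • x) = a * f x := by
    intro x hx a ha ha1
    have := hf x hx 0 W.zero_mem a (1 - a) ha (sub_nonneg.2 ha1) (by ring)
    simpa [h0] using this
  have hnn : ∀ x ∈ W, ∀ a : ℝ, 0 ≤ a → f (a • x) = a * f x := by
    intro x hx a ha
    rcases le_total a 1 with h | h
    · exact hle x hx a ha h
    · have h' : 0 < a := by linarith
      have := hle (a • x) (W.smul_mem _ hx) a⁻¹ (by positivity) (inv_le_one_of_one_le₀ h)
      rw [smul_smul, inv_mul_cancel₀ h'.ne', one_smul] at this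
      rw [this]
      field_simp
  have hadd : ∀ x ∈ W, ∀ y ∈ W, f (x + y) = f x + f y := by
    intro x hx y hy
    have := hf _ (W.smul_mem 2 hx) _ (W.smul_mem 2 hy) (1 / 2) (1 / 2) (by norm_num) (by norm_num)
      (by norm_num)
    rw [hnn x hx 2 (by norm_num), hnn y hy 2 (by norm_num), smul_smul, smul_smul] at this
    norm_num at this
    linarith
  refine ⟨hadd, fun x hx a => ?_⟩
  rcases le_total 0 a with h | h
  · exact hnn x hx a h
  · have h1 := hadd (a • x) (W.smul_mem _ hx) ((-a) • x) (W.smul_mem _ hx)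
    rw [hnn x hx (-a) (by linarith), ← add_smul, add_neg_cancel, zero_smul, h0] at h1
    linarith

/-- The zero set, in a subspace where it is nonnegative, of a convex function which is polynomial
on rays and vanishes at the origin. -/
def zeroSubmodule {V : Type*} [AddCommGroup V] [Module ℝ V] {d : ℕ} {h : V → ℝ}
    (hc : ConvexOn ℝ Set.univ h) (hp : IsPolynomialOnRays d h) (h0 : h 0 = 0) (W : Submodule ℝ V)
    (hW : ∀ x ∈ W, 0 ≤ h x) : Submodule ℝ V :=
  have hsmul : ∀ (a : ℝ) (x : V), x ∈ W → h x = 0 → h (a • x) = 0 := by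
    intro a x hx hx0
    obtain ⟨p, -, hpe⟩ := hp x
    have hp0 : p = 0 := by
      refine Polynomial.eq_zero_of_infinite_isRoot p ((Set.Icc_infinite one_pos).mono ?_)
      intro t ht
      have h1 := hc.map_smul_le_of_map_zero h0 ht.1 ht.2 x
      have h2 := hW _ (W.smul_mem t hx)
      rw [hx0, mul_zero] at h1
      exact (hpe t).symm.trans (le_antisymm h1 h2)
    rw [hpe, hp0, Polynomial.eval_zero]
  { carrier := {x | x ∈ W ∧ h x = 0}
    zero_mem' := ⟨W.zero_mem, h0⟩
    add_mem' := by
      rintro x y ⟨hx, hx0⟩ ⟨hy, hy0⟩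
      refine ⟨W.add_mem hx hy, le_antisymm ?_ (hW _ (W.add_mem hx hy))⟩
      have := hc.map_add_le_of_two_smul x y
      rw [hsmul 2 x hx hx0, hsmul 2 y hy hy0] at this
      linarith
    smul_mem' := by
      rintro a x ⟨hx, hx0⟩
      exact ⟨W.smul_mem _ hx, hsmul a x hx hx0⟩ }

/-- Hölder error bound with exponent `1 / d` for a single nonnegative convex function which is
polynomial of degree at most `d` on rays. -/
lemma exists_norm_pow_le_of_nonneg {d : ℕ} (hd : d ≠ 0) {h : E → ℝ}
    (hc : ConvexOn ℝ Set.univ h) (hp : IsPolynomialOnRays d h) (h0 : h 0 = 0) (W : Submodule ℝ E)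
    (hW : ∀ x ∈ W, 0 ≤ h x) (R : ℝ) :
    ∃ A ≥ (0 : ℝ), ∀ x ∈ W, ‖x‖ ≤ R →
      ∃ y, x - y ∈ zeroSubmodule hc hp h0 W hW ∧ ‖y‖ ^ d ≤ A * h x := by
  obtain ⟨K, hK, hgrow⟩ := exists_pow_mul_le_of_convexOn_of_isPolynomialOnRays E d
  set Z := zeroSubmodule hc hp h0 W hW with hZ
  have hZW : Z ≤ W := fun x hx => hx.1
  let T : Set E := sphere 0 (|R| + 1) ∩ ((W : Set E) ∩ (Zᗮ : Submodule ℝ E))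
  have hR : 0 < |R| + 1 := by positivity
  have hT : IsCompact T := (isCompact_sphere _ _).inter_right
    ((Submodule.closed_of_finiteDimensional W).inter (Submodule.closed_of_finiteDimensional _))
  have hcont : Continuous h := hc.locallyLipschitz.continuous
  obtain ⟨δ, hδ, hTδ⟩ : ∃ δ > (0 : ℝ), ∀ x ∈ T, δ ≤ h x := by
    rcases T.eq_empty_or_nonempty with hT0 | hT0
    · exact ⟨1, one_pos, fun x hx => by simp [hT0] at hx⟩
    · obtain ⟨x₀, hx₀, hmin⟩ := hT.exists_isMinOn hT0 hcont.continuousOn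
      refine ⟨h x₀, lt_of_le_of_ne (hW _ hx₀.2.1) fun hz => ?_, fun x hx => hmin hx⟩
      have hmem : x₀ ∈ Z := ⟨hx₀.2.1, hz.symm⟩
      have hz0 : x₀ = 0 := by
        have := hx₀.2.2 x₀ hmem
        simpa using this
      have := hx₀.1
      rw [hz0] at this
      simp at this
      linarith
  have key : ∀ y ∈ W, y ∈ Zᗮ → ‖y‖ ≤ |R| + 1 → y ≠ 0 →
      ‖y‖ ^ d * δ ≤ K * (|R| + 1) ^ d * h y := by
    intro y hyW hyZ hyR hy0
    have hy : 0 < ‖y‖ := norm_pos_iff.2 hy0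
    set u := ((|R| + 1) / ‖y‖) • y with hu
    have huT : u ∈ T := by
      refine ⟨?_, W.smul_mem _ hyW, Submodule.smul_mem _ _ hyZ⟩
      rw [mem_sphere_zero_iff_norm, hu, norm_smul, norm_div, norm_norm, Real.norm_eq_abs,
        abs_of_pos hR]
      field_simp
    have h1 := hgrow hc hp h0 u (fun t => hW _ (W.smul_mem _ huT.2.1)) (‖y‖ / (|R| + 1))
      (by positivity) (by rw [div_le_one hR]; exact hyR)
    have e1 : (‖y‖ / (|R| + 1)) • u = y := by
      rw [hu, smul_smul]
      have : ‖y‖ / (|R| + 1) * ((|R| + 1) / ‖y‖) = 1 := by field_simp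
      rw [this, one_smul]
    rw [e1, div_pow] at h1
    have h2 := hTδ u huT
    calc ‖y‖ ^ d * δ ≤ ‖y‖ ^ d * h u := by gcongr
      _ = (|R| + 1) ^ d * (‖y‖ ^ d / (|R| + 1) ^ d * h u) := by field_simp
      _ ≤ (|R| + 1) ^ d * (K * h y) := by gcongr
      _ = _ := by ring
  refine ⟨K * (|R| + 1) ^ d * (K * 2 ^ d) / δ + 1, by positivity, fun x hx hxR => ?_⟩
  by_cases hxZ : x ∈ Z
  · exact ⟨0, by rwa [sub_zero], by simp [hd, hxZ.2]⟩
  set z := Z.starProjection x with hz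
  have hzZ : z ∈ Z := Z.starProjection_apply_mem x
  have hyo : x - z ∈ Zᗮ := Z.sub_starProjection_mem_orthogonal x
  have hyn : ‖x - z‖ ≤ |R| + 1 := by
    rw [hz, ← Z.starProjection_orthogonal_val]
    have := Zᗮ.norm_starProjection_apply_le x
    linarith [le_abs_self R]
  have hy0 : x - z ≠ 0 := fun h => hxZ (by rwa [sub_eq_zero.1 h])
  have h1 := key _ (W.sub_mem hx (hZW hzZ)) hyo hyn hy0
  refine ⟨x - z, by simpa using hzZ, ?_⟩
  have h2 : h (x - z) ≤ h ((2 : ℝ) • x) := by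
    have h3 := hc.map_add_le_of_two_smul x (-z)
    have h4 : h ((2 : ℝ) • (-z)) = 0 := (Z.smul_mem 2 (Z.neg_mem hzZ)).2
    have h5 := hW _ (W.smul_mem 2 hx)
    rw [← sub_eq_add_neg] at h3
    linarith
  have h3 := hgrow hc hp h0 ((2 : ℝ) • x) (fun t => hW _ (W.smul_mem _ (W.smul_mem _ hx))) (1 / 2)
    (by norm_num) (by norm_num)
  have e2 : (1 / 2 : ℝ) • (2 : ℝ) • x = x := by rw [smul_smul]; norm_num
  rw [e2] at h3
  have h4 : h ((2 : ℝ) • x) ≤ K * 2 ^ d * h x := by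
    calc h ((2 : ℝ) • x) = 2 ^ d * ((1 / 2) ^ d * h ((2 : ℝ) • x)) := by
          rw [← mul_assoc, ← mul_pow]; norm_num
      _ ≤ 2 ^ d * (K * h x) := by gcongr
      _ = _ := by ring
  have h5 : ‖x - z‖ ^ d * δ ≤ K * (|R| + 1) ^ d * (K * 2 ^ d * h x) :=
    h1.trans (by gcongr; exact h2.trans h4)
  have h6 := hW x hx
  have h7 : ‖x - z‖ ^ d ≤ K * (|R| + 1) ^ d * (K * 2 ^ d * h x) / δ := by
    rwa [le_div_iff₀ hδ]
  refine h7.trans ?_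
  have : K * (|R| + 1) ^ d * (K * 2 ^ d * h x) / δ = K * (|R| + 1) ^ d * (K * 2 ^ d) / δ * h x := by
    ring
  rw [this]
  linarith

/-- Hölder error bound for a system of convex functions, polynomial on rays, all of which vanish
on the solution set of the system in a subspace `W`; the exponent is `1 / d ^ dim W`. -/
theorem exists_holder_bound_of_forall_eq_zero {ι : Type*} {d : ℕ} (hd : 0 < d) {g : ι → E → ℝ}
    (hg : ∀ i, ConvexOn ℝ Set.univ (g i)) (hp : ∀ i, IsPolynomialOnRays d (g i))
    (W : Submodule ℝ E) (I : Finset ι) (h0 : ∀ i ∈ I, g i 0 = 0)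
    (hI : ∀ x ∈ W, (∀ i ∈ I, g i x ≤ 0) → ∀ i ∈ I, g i x = 0) (R : ℝ) :
    ∃ C ≥ (0 : ℝ), ∀ x ∈ W, ‖x‖ ≤ R → ∀ s ≥ (0 : ℝ),
      (∀ i ∈ I, g i x ≤ s ^ d ^ Module.finrank ℝ W) →
      ∃ y, (y ∈ W ∧ ∀ i ∈ I, g i y = 0) ∧ ‖x - y‖ ≤ C * s := by
  classical
  induction hN : I.card + Module.finrank ℝ W using Nat.strong_induction_on
    generalizing W I R with
  | _ N ih =>
  rcases I.eq_empty_or_nonempty with rfl | hne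
  · exact ⟨0, le_rfl, fun x hx _ s _ _ => ⟨x, by simp [hx], by simp⟩⟩
  have hneI : Nonempty I := hne.to_subtype
  obtain ⟨w, hw, ⟨i₀, hi₀⟩, hsum⟩ := exists_nonneg_combination_of_forall_exists_nonneg
    (g := fun i : I => g i) (fun i => hg i) W fun x hx => by
      by_contra! hcon
      obtain ⟨i, hi⟩ := hne
      have h1 := hI x hx (fun i hi => (hcon ⟨i, hi⟩).le) i hi
      exact (hcon ⟨i, hi⟩).ne h1
  by_cases hzero : ∀ x ∈ W, ∑ i : I, w i * g i x = 0
  · have haff : ∀ x ∈ W, ∀ y ∈ W, ∀ a b : ℝ, 0 ≤ a → 0 ≤ b → a + b = 1 →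
        g i₀ (a • x + b • y) = a * g i₀ x + b * g i₀ y := by
      intro x hx y hy a b ha hb hab
      have hterm : ∀ i : I, w i * (g i (a • x + b • y) - (a * g i x + b * g i y)) ≤ 0 := fun i =>
        mul_nonpos_of_nonneg_of_nonpos (hw i)
          (sub_nonpos.2 ((hg i).2 (mem_univ x) (mem_univ y) ha hb hab))
      have htot : ∑ i : I, w i * (g i (a • x + b • y) - (a * g i x + b * g i y)) = 0 := by
        have e : ∀ i : I, w i * (g i (a • x + b • y) - (a * g i x + b * g i y)) =
            w i * g i (a • x + b • y) - (a * (w i * g i x) + b * (w i * g i y)) := fun i => by ring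
        simp_rw [e]
        rw [Finset.sum_sub_distrib, Finset.sum_add_distrib, ← Finset.mul_sum, ← Finset.mul_sum,
          hzero x hx, hzero y hy, hzero _ (W.add_mem (W.smul_mem a hx) (W.smul_mem b hy))]
        simp
      have := (Finset.sum_eq_zero_iff_of_nonpos fun i _ => hterm i).1 htot i₀ (Finset.mem_univ _)
      rcases mul_eq_zero.1 this with h | h
      · exact absurd h hi₀.ne'
      · linarith
    obtain ⟨hadd, hsmul⟩ := map_add_and_map_smul_of_affine_on_segments (h0 i₀ i₀.2) haff
    let Z : Submodule ℝ E :=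
      { carrier := {x | x ∈ W ∧ g i₀ x = 0}
        zero_mem' := ⟨W.zero_mem, h0 i₀ i₀.2⟩
        add_mem' := fun {x y} hx hy =>
          ⟨W.add_mem hx.1 hy.1, by rw [hadd x hx.1 y hy.1, hx.2, hy.2, add_zero]⟩
        smul_mem' := fun a x hx => ⟨W.smul_mem a hx.1, by rw [hsmul x hx.1, hx.2, mul_zero]⟩ }
    have hZW : Z ≤ W := fun x hx => hx.1
    have hrank : Module.finrank ℝ Z ≤ Module.finrank ℝ W := Submodule.finrank_mono hZW
    have hcard := Finset.card_erase_lt_of_mem i₀.2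
    have hback : ∀ x ∈ Z, (∀ i ∈ I.erase i₀, g i x ≤ 0) → ∀ i ∈ I, g i x = 0 := fun x hx h =>
      hI x hx.1 fun i hi => by
        by_cases hii : i = i₀
        · rw [hii]; exact hx.2.le
        · exact h i (Finset.mem_erase.2 ⟨hii, hi⟩)
    have hpow := Nat.pow_le_pow_right hd hrank
    have hIH : ∀ R : ℝ, ∃ C ≥ (0 : ℝ), ∀ x ∈ Z, ‖x‖ ≤ R → ∀ s ≥ (0 : ℝ),
        (∀ i ∈ I.erase i₀, g i x ≤ s ^ d ^ Module.finrank ℝ Z) →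
        ∃ y, (y ∈ W ∧ ∀ i ∈ I, g i y = 0) ∧ ‖x - y‖ ≤ C * s := by
      intro R
      obtain ⟨C, hC, h⟩ := ih _ (by omega) Z (I.erase i₀)
        (fun i hi => h0 i (Finset.mem_of_mem_erase hi))
        (fun x hx h i hi => hback x hx h i (Finset.mem_of_mem_erase hi)) R rfl
      refine ⟨C, hC, fun x hx hxR s hs hgx => ?_⟩
      obtain ⟨y, ⟨hyZ, hy⟩, hxy⟩ := h x hx hxR s hs hgx
      exact ⟨y, ⟨hyZ.1, hback y hyZ fun i hi => (hy i hi).le⟩, hxy⟩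
    refine exists_holder_bound_of_correction hg (Z := Z) (I' := I.erase i₀) (e := 1)
      (N' := d ^ Module.finrank ℝ Z) (Finset.erase_subset _ _)
      (by positivity) (by simpa using hpow) hpow
      ⟨W.zero_mem, h0⟩ (fun R => ?_) hIH R
    have hsw : 0 ≤ ∑ i : I, w i := Finset.sum_nonneg fun i _ => hw i
    have habs : ∀ x ∈ W, ∀ s ≥ (0 : ℝ), (∀ i ∈ I, g i x ≤ s ^ 1) →
        |g i₀ x| ≤ ((∑ i : I, w i) / w i₀ + 1) * s := by
      intro x hx s hs hgx
      have h1 : ∑ i : I, w i * (s - g i x) = (∑ i : I, w i) * s := by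
        simp_rw [mul_sub]
        rw [Finset.sum_sub_distrib, hzero x hx, sub_zero, Finset.sum_mul]
      have h2 : w i₀ * (s - g i₀ x) ≤ ∑ i : I, w i * (s - g i x) :=
        Finset.single_le_sum (f := fun i : I => w i * (s - g i x))
          (fun i _ => mul_nonneg (hw i) (by have := hgx i i.2; rw [pow_one] at this; linarith))
          (Finset.mem_univ i₀)
      have h3 : s - g i₀ x ≤ (∑ i : I, w i) / w i₀ * s := by
        rw [div_mul_eq_mul_div, le_div_iff₀ hi₀]
        linarith
      have h4 := hgx i₀ i₀.2
      rw [pow_one] at h4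
      have h5 : 0 ≤ (∑ i : I, w i) / w i₀ * s := by positivity
      rw [abs_le]
      constructor <;> linarith
    by_cases hx₁ : ∃ x₁ ∈ W, g i₀ x₁ ≠ 0
    · obtain ⟨x₁, hx₁, hgx₁⟩ := hx₁
      refine ⟨((∑ i : I, w i) / w i₀ + 1) * ‖(g i₀ x₁)⁻¹ • x₁‖, by positivity,
        fun x hx _ s hs hgx => ⟨g i₀ x • (g i₀ x₁)⁻¹ • x₁, ⟨?_, ?_⟩, ?_⟩⟩
      · exact W.sub_mem hx (W.smul_mem _ (W.smul_mem _ hx₁))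
      · rw [sub_eq_add_neg, smul_smul, ← neg_smul, hadd x hx _ (W.smul_mem _ hx₁), hsmul x₁ hx₁]
        field_simp
        ring
      · rw [norm_smul, Real.norm_eq_abs]
        have := mul_le_mul_of_nonneg_right (habs x hx s hs hgx) (norm_nonneg ((g i₀ x₁)⁻¹ • x₁))
        linarith
    · push Not at hx₁
      exact ⟨0, le_rfl, fun x hx _ s _ _ => ⟨0, ⟨by rwa [sub_zero], hx₁ _ (by rwa [sub_zero])⟩,
        by simp⟩⟩
  · push Not at hzero
    obtain ⟨x₁, hx₁W, hx₁⟩ := hzero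
    have hc := ConvexOn.sum_mul (g := fun i : I => g i) (fun i => hg i) hw
    have hpr := IsPolynomialOnRays.sum_mul (g := fun i : I => g i) (fun i => hp i) w
    have hz : ∑ i : I, w i * g i 0 = 0 :=
      Finset.sum_eq_zero fun i _ => by rw [h0 i i.2, mul_zero]
    set Z := zeroSubmodule hc hpr hz W hsum with hZ
    have hZW : Z < W := by
      refine lt_of_le_of_ne (fun x hx => hx.1) fun heq => hx₁ ?_
      rw [← heq] at hx₁W
      exact hx₁W.2
    have hrank : Module.finrank ℝ Z < Module.finrank ℝ W := Submodule.finrank_lt_finrank_of_lt hZW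
    refine exists_holder_bound_of_correction hg (Z := Z) (e := d) (N' := d ^ Module.finrank ℝ Z)
      subset_rfl (by positivity) ?_ (Nat.pow_le_pow_right hd hrank.le)
      ⟨W.zero_mem, h0⟩ (fun R => ?_) (fun R => ?_) R
    rotate_right
    · obtain ⟨C, hC, h⟩ := ih _ (by omega) Z I h0 (fun x hx => hI x hx.1) R rfl
      refine ⟨C, hC, fun x hx hxR s hs hgx => ?_⟩
      obtain ⟨y, ⟨hyZ, hy⟩, hxy⟩ := h x hx hxR s hs hgx
      exact ⟨y, ⟨hyZ.1, hy⟩, hxy⟩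
    · rw [← pow_succ']
      exact Nat.pow_le_pow_right hd hrank
    obtain ⟨A, hA, hAb⟩ := exists_norm_pow_le_of_nonneg hd.ne' hc hpr hz W hsum R
    have hw0 : 0 ≤ ∑ i : I, w i := Finset.sum_nonneg fun i _ => hw i
    refine ⟨A * (∑ i : I, w i) + 1, by positivity, fun x hx hxR s hs hgx => ?_⟩
    obtain ⟨y, hyZ, hy⟩ := hAb x hx hxR
    refine ⟨y, hyZ, ?_⟩
    refine le_of_pow_le_pow_left₀ hd.ne' (by positivity) (hy.trans ?_)
    have h1 : ∑ i : I, w i * g i x ≤ (∑ i : I, w i) * s ^ d := by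
      rw [Finset.sum_mul]
      exact Finset.sum_le_sum fun i _ => mul_le_mul_of_nonneg_left (hgx i i.2) (hw i)
    have hB : 0 ≤ A * ∑ i : I, w i := by positivity
    calc A * ∑ i : I, w i * g i x ≤ A * ((∑ i : I, w i) * s ^ d) := by gcongr
      _ = (A * ∑ i : I, w i) * s ^ d := by ring
      _ ≤ (A * (∑ i : I, w i) + 1) ^ d * s ^ d := by
          gcongr
          exact (by linarith : A * ∑ i : I, w i ≤ A * (∑ i : I, w i) + 1).trans
            (le_self_pow₀ (by linarith) hd.ne')
      _ = _ := (mul_pow _ _ _).symm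

/-- A solution of a convex system at which all constraints that are not identically zero on the
solution set are strict. -/
lemma exists_slater_point {V ι : Type*} [AddCommGroup V] [Module ℝ V] {g : ι → V → ℝ}
    (hg : ∀ i, ConvexOn ℝ Set.univ (g i)) {xbar : V} (hxbar : ∀ i, g i xbar ≤ 0) (T : Finset ι)
    (hT : ∀ j ∈ T, ∃ x, (∀ i, g i x ≤ 0) ∧ g j x < 0) :
    ∃ x₀, (∀ i, g i x₀ ≤ 0) ∧ ∃ δ > (0 : ℝ), ∀ j ∈ T, g j x₀ ≤ -δ := by
  classical
  induction T using Finset.induction_on with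
  | empty => exact ⟨xbar, hxbar, 1, one_pos, by simp⟩
  | insert j T _ ih =>
    obtain ⟨x₀, hx₀, δ, hδ, hx₀T⟩ := ih fun k hk => hT k (Finset.mem_insert_of_mem hk)
    obtain ⟨y, hy, hyj⟩ := hT j (Finset.mem_insert_self _ _)
    have hmid : ∀ i, g i ((1 / 2 : ℝ) • x₀ + (1 / 2 : ℝ) • y) ≤ 1 / 2 * g i x₀ + 1 / 2 * g i y :=
      fun i => (hg i).2 (mem_univ _) (mem_univ _) (by norm_num) (by norm_num) (by norm_num)
    refine ⟨_, fun i => (hmid i).trans (by linarith [hx₀ i, hy i]), min δ (-g j y) / 2,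
      half_pos (lt_min hδ (by linarith)), fun k hk => (hmid k).trans ?_⟩
    rcases Finset.mem_insert.1 hk with rfl | hk
    · linarith [min_le_right δ (-g k y), hx₀ k]
    · linarith [min_le_left δ (-g j y), hx₀T k hk, hy k]

/-- Local error bound for a finite system of convex functions which are polynomial of degree at
most `d` on lines through the reference point, with the dimension-dependent exponent
`1 / d ^ dim E` for the constraints vanishing identically on the solution set. -/
theorem exists_local_error_bound {ι : Type*} [Finite ι] {d : ℕ} (hd : 0 < d) {g : ι → E → ℝ}
    (hg : ∀ i, ConvexOn ℝ Set.univ (g i)) {xbar : E}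
    (hp : ∀ i, IsPolynomialOnRays d (fun x => g i (xbar + x)))
    {S : Set E} (hS : S = {x | ∀ i, g i x ≤ 0}) (hxbar : xbar ∈ S) :
    ∃ C ≥ (0 : ℝ), ∀ x, ‖x - xbar‖ ≤ 1 → ∀ M ≥ (0 : ℝ), ∀ s ≥ (0 : ℝ),
      (∀ i, (¬ ∀ x ∈ S, g i x = 0) → g i x ≤ M) →
      (∀ i, (∀ x ∈ S, g i x = 0) → g i x ≤ s ^ d ^ Module.finrank ℝ E) →
      infDist x S ≤ C * (M + s) := by
  classical
  have := Fintype.ofFinite ι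
  let I₀ : Finset ι := Finset.univ.filter fun i => ∀ x ∈ S, g i x = 0
  let I₁ : Finset ι := Finset.univ.filter fun i => ¬ ∀ x ∈ S, g i x = 0
  have hI₀ : ∀ {i}, i ∈ I₀ ↔ ∀ x ∈ S, g i x = 0 := by simp [I₀]
  have hI₁ : ∀ {i}, i ∈ I₁ ↔ ¬ ∀ x ∈ S, g i x = 0 := by simp [I₁]
  have hxbar' : ∀ i, g i xbar ≤ 0 := by rwa [hS] at hxbar
  obtain ⟨x₀, hx₀, δ, hδ, hx₀δ⟩ := exists_slater_point hg hxbar' I₁ fun j hj => by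
    have := hI₁.1 hj
    push Not at this
    obtain ⟨x, hx, hxj⟩ := this
    rw [hS] at hx
    exact ⟨x, hx, lt_of_le_of_ne (hx j) hxj⟩
  have hmove : ∀ y, (∀ i ∈ I₀, g i y ≤ 0) → ∀ M : ℝ, 0 ≤ M → (∀ j ∈ I₁, g j y ≤ M) →
      (M / (M + δ)) • x₀ + (δ / (M + δ)) • y ∈ S := by
    intro y hy M hM hyM
    rw [hS]
    intro i
    have hMδ : 0 < M + δ := by linarith
    refine ((hg i).2 (mem_univ _) (mem_univ _) (by positivity) (by positivity)
      (by field_simp)).trans ?_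
    simp only [smul_eq_mul]
    have e : M / (M + δ) * g i x₀ + δ / (M + δ) * g i y = (M * g i x₀ + δ * g i y) / (M + δ) := by
      ring
    rw [e]
    refine div_nonpos_of_nonpos_of_nonneg ?_ hMδ.le
    by_cases hi : ∀ x ∈ S, g i x = 0
    · nlinarith [hy i (hI₀.2 hi), hx₀ i]
    · nlinarith [hyM i (hI₁.2 hi), hx₀δ i (hI₁.2 hi)]
  have hzero : ∀ y, (∀ i ∈ I₀, g i y ≤ 0) → ∀ i ∈ I₀, g i y = 0 := by
    intro y hy i hi
    obtain ⟨M, hM, hyM⟩ : ∃ M : ℝ, 0 ≤ M ∧ ∀ j ∈ I₁, g j y ≤ M :=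
      ⟨∑ j ∈ I₁, |g j y|, Finset.sum_nonneg fun _ _ => abs_nonneg _, fun j hj =>
        (le_abs_self _).trans
          (Finset.single_le_sum (f := fun j => |g j y|) (fun _ _ => abs_nonneg _) hj)⟩
    have hMδ : 0 < M + δ := by linarith
    have h1 := hI₀.1 hi _ (hmove y hy M hM hyM)
    have h2 := (hg i).2 (mem_univ x₀) (mem_univ y) (by positivity : 0 ≤ M / (M + δ))
      (by positivity : 0 ≤ δ / (M + δ)) (by field_simp)
    simp only [smul_eq_mul] at h2
    have h3 : 0 < δ / (M + δ) := by positivity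
    have h4 : M / (M + δ) * g i x₀ ≤ 0 :=
      mul_nonpos_of_nonneg_of_nonpos (by positivity) (hx₀ i)
    refine le_antisymm (hy i hi) (le_of_mul_le_mul_left ?_ h3)
    linarith
  have hconv : ∀ i, ConvexOn ℝ Set.univ (fun x => g i (xbar + x)) := fun i => by
    simpa [Function.comp_def] using (hg i).translate_right xbar
  obtain ⟨C, hC, hbound⟩ := exists_holder_bound_of_forall_eq_zero hd hconv hp ⊤ I₀
    (fun i hi => by simpa using hI₀.1 hi xbar hxbar) (fun x _ hx => hzero _ hx) 1
  obtain ⟨L, hL, hLip⟩ := exists_forall_map_sub_le hg I₁ (‖xbar‖ + 1 + C)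
  set D : ℝ := ‖xbar‖ + 1 + C + ‖x₀‖ with hD
  have hD0 : 0 ≤ D := by positivity
  refine ⟨C + (1 + L * C) * D / δ + 1, by positivity, fun x hx M hM s hs hx₁ hx₀' => ?_⟩
  have hK : 0 ≤ C + (1 + L * C) * D / δ := by positivity
  rcases le_total 1 s with hs1 | hs1
  · calc infDist x S ≤ dist x xbar := infDist_le_dist_of_mem hxbar
      _ ≤ 1 := by rwa [dist_eq_norm]
      _ ≤ _ := by nlinarith
  obtain ⟨y, ⟨-, hy⟩, hxy⟩ := hbound (x - xbar) trivial hx s hs fun i hi => by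
    rw [finrank_top]
    simpa using hx₀' i (hI₀.1 hi)
  set v := x - (xbar + y) with hv
  have hvn : ‖v‖ ≤ C * s := by
    have e : v = x - xbar - y := by rw [hv]; abel
    rwa [e]
  have hyv : xbar + y = x - v := by rw [hv]; abel
  have hxn : ‖x‖ ≤ ‖xbar‖ + 1 := by
    have := norm_add_le xbar (x - xbar)
    rw [add_sub_cancel] at this
    linarith
  have hvC : ‖v‖ ≤ C := hvn.trans (by nlinarith)
  have hyn : ‖x - v‖ ≤ ‖xbar‖ + 1 + C := (norm_sub_le _ _).trans (by linarith)
  set N : ℝ := M + L * (C * s) with hN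
  have hN0 : 0 ≤ N := by positivity
  have hNδ : 0 < N + δ := by linarith
  have hyN : ∀ j ∈ I₁, g j (x - v) ≤ N := fun j hj =>
    (hLip j hj x v (by linarith) hyn).trans
      (add_le_add (hx₁ j (hI₁.1 hj)) (mul_le_mul_of_nonneg_left hvn hL))
  have hmem := hmove (x - v) (fun i hi => by rw [← hyv]; exact (hy i hi).le) N hN0 hyN
  have e1 : x - ((N / (N + δ)) • x₀ + (δ / (N + δ)) • (x - v)) =
      v + (N / (N + δ)) • (x - v - x₀) := by
    have : δ / (N + δ) = 1 - N / (N + δ) := by field_simp; ring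
    rw [this]
    module
  have h3 : ‖x - v - x₀‖ ≤ D := (norm_sub_le _ _).trans (by linarith)
  have h4 : N / (N + δ) ≤ N / δ := div_le_div_of_nonneg_left hN0 hδ (by linarith)
  calc infDist x S ≤ dist x _ := infDist_le_dist_of_mem hmem
    _ ≤ ‖v‖ + N / (N + δ) * ‖x - v - x₀‖ := by
        rw [dist_eq_norm, e1]
        refine (norm_add_le _ _).trans_eq ?_
        rw [norm_smul, Real.norm_eq_abs, abs_of_nonneg (by positivity)]
    _ ≤ C * s + N / δ * D := by gcongr
    _ ≤ C * (M + s) + (1 + L * C) * (M + s) / δ * D := by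
        gcongr
        · linarith
        · rw [hN]
          nlinarith [mul_nonneg (mul_nonneg hL hC) hM]
    _ = (C + (1 + L * C) * D / δ) * (M + s) := by ring
    _ ≤ _ := mul_le_mul_of_nonneg_right (by linarith) (by positivity)

end

lemma MvPolynomial.isPolynomialOnRays_eval {n d : ℕ} {p : MvPolynomial (Fin n) ℝ}
    (hp : p.totalDegree ≤ d) (y : EuclideanSpace ℝ (Fin n)) :
    IsPolynomialOnRays d
      (fun x : EuclideanSpace ℝ (Fin n) => MvPolynomial.eval (fun j => (y + x) j) p) := by
  intro v
  refine ⟨MvPolynomial.aeval (fun j => Polynomial.C (v j) * Polynomial.X + Polynomial.C (y j)) p,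
    ?_, fun t => ?_⟩
  · have := MvPolynomial.aeval_natDegree_le p hp
      (fun j => Polynomial.C (v j) * Polynomial.X + Polynomial.C (y j)) (n := 1)
      (fun j => Polynomial.natDegree_linear_le)
    rwa [mul_one] at this
  · rw [← Polynomial.coe_evalRingHom, MvPolynomial.aeval_def, MvPolynomial.hom_eval₂,
      ← MvPolynomial.coe_eval₂Hom]
    change MvPolynomial.eval₂Hom _ _ p = _
    congr 1
    ext j
    · simp
    · simp only [MvPolynomial.eval₂Hom_X', PiLp.add_apply, PiLp.smul_apply, smul_eq_mul,
        Polynomial.coe_evalRingHom, Polynomial.eval_add, Polynomial.eval_mul, Polynomial.eval_C,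
        Polynomial.eval_X]
      ring

lemma biSup_max_zero_bounds {κ : Type*} [Finite κ] (f : κ → ℝ) (J : Set κ) :
    0 ≤ (⨆ i ∈ J, max (f i) 0) ∧ ∀ i ∈ J, f i ≤ ⨆ i ∈ J, max (f i) 0 := by
  refine ⟨Real.iSup_nonneg fun i => Real.iSup_nonneg fun _ => le_max_right _ _, fun i hi => ?_⟩
  have h1 : (⨆ _ : i ∈ J, max (f i) 0) ≤ ⨆ i ∈ J, max (f i) 0 :=
    le_ciSup (f := fun i => ⨆ _ : i ∈ J, max (f i) 0) (Set.finite_range _).bddAbove i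
  rw [ciSup_pos hi] at h1
  exact (le_max_left _ _).trans h1

lemma two_mul_pow_le_pow_add_one {n : ℕ} (hn : 0 < n) {a : ℝ} (ha : 1 ≤ a) :
    2 * a ^ n ≤ (2 * a - 1) ^ n + 1 := by
  obtain ⟨k, rfl⟩ := Nat.exists_eq_succ_of_ne_zero hn.ne'
  have h := add_pow_le (by linarith : 0 ≤ 2 * a - 1) zero_le_one (k + 1)
  rw [one_pow, sub_add_cancel, Nat.add_sub_cancel, mul_pow] at h
  have h2 : (0 : ℝ) < 2 ^ k := by positivity
  refine le_of_mul_le_mul_left ?_ h2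
  calc (2 : ℝ) ^ k * (2 * a ^ (k + 1)) = 2 ^ (k + 1) * a ^ (k + 1) := by ring
    _ ≤ _ := h

/-- Local error bounds for convex polynomial systems (Theorem 3.1). -/
theorem local_error_bound_convex_polynomial_system
    (n m d : ℕ) (hn : 0 < n) (hm : 0 < m) (hd : 0 < d)
    (g : Fin m → EuclideanSpace ℝ (Fin n) → ℝ)
    (hpoly : ∀ i, ∃ p : MvPolynomial (Fin n) ℝ, p.totalDegree ≤ d ∧
      ∀ x : EuclideanSpace ℝ (Fin n), g i x = MvPolynomial.eval (fun j => x j) p)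
    (hconv : ∀ i, ConvexOn ℝ Set.univ (g i))
    (S : Set (EuclideanSpace ℝ (Fin n)))
    (hS : S = {x | ∀ i, g i x ≤ 0})
    (xbar : EuclideanSpace ℝ (Fin n)) (hxbar : xbar ∈ S)
    (J0 J1 : Set (Fin m))
    (hJ0 : J0 = {i | ∀ x ∈ S, g i x = 0}) (hJ1 : J1 = J0ᶜ)
    (τ : ℝ)
    (hτ : τ = max (2 / ((2 * (d : ℝ) - 1) ^ n + 1))
                  (1 / ((Nat.choose (n - 1) ((n - 1) / 2) : ℝ) * (d : ℝ) ^ n))) :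
    ∃ c > (0 : ℝ), ∃ ε > (0 : ℝ), ∀ x : EuclideanSpace ℝ (Fin n), ‖x - xbar‖ ≤ ε →
      Metric.infDist x S ≤
        c * ((⨆ i ∈ J1, max (g i x) 0) + (⨆ i ∈ J0, max (g i x) 0) ^ τ) := by
  have hpr : ∀ i, IsPolynomialOnRays d (fun x => g i (xbar + x)) := fun i => by
    obtain ⟨p, hp, hpe⟩ := hpoly i
    simp_rw [hpe]
    exact MvPolynomial.isPolynomialOnRays_eval hp xbar
  obtain ⟨C, hC, hbound⟩ := exists_local_error_bound hd hconv hpr hS hxbar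
  have hd1 : (1 : ℝ) ≤ d := by exact_mod_cast hd
  have hdn : (0 : ℝ) < (d : ℝ) ^ n := by positivity
  have hchoose : (1 : ℝ) ≤ Nat.choose (n - 1) ((n - 1) / 2) := by
    exact_mod_cast Nat.choose_pos (Nat.div_le_self _ _)
  have hτ0 : 0 < τ := by
    rw [hτ]
    exact lt_max_of_lt_right (by positivity)
  have hτle : τ ≤ 1 / (d : ℝ) ^ n := by
    rw [hτ]
    refine max_le ?_ ?_
    · have h := two_mul_pow_le_pow_add_one hn hd1
      rw [div_le_div_iff₀ (by linarith) hdn]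
      linarith
    · exact one_div_le_one_div_of_le hdn (le_mul_of_one_le_left hdn.le hchoose)
  refine ⟨C + 1, by linarith, 1, one_pos, fun x hx => ?_⟩
  obtain ⟨hM₁, hM₁x⟩ := biSup_max_zero_bounds (fun i => g i x) J1
  obtain ⟨hM₀, hM₀x⟩ := biSup_max_zero_bounds (fun i => g i x) J0
  set M₁ := ⨆ i ∈ J1, max (g i x) 0
  set M₀ := ⨆ i ∈ J0, max (g i x) 0
  rcases le_total 1 M₀ with h1 | h1
  · have h2 : 1 ≤ M₀ ^ τ := Real.one_le_rpow h1 hτ0.le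
    calc infDist x S ≤ dist x xbar := infDist_le_dist_of_mem hxbar
      _ ≤ 1 := by rwa [dist_eq_norm]
      _ ≤ _ := by nlinarith
  have hs : (0 : ℝ) ≤ M₀ ^ (1 / (d : ℝ) ^ n) := Real.rpow_nonneg hM₀ _
  have hsτ : M₀ ^ (1 / (d : ℝ) ^ n) ≤ M₀ ^ τ :=
    Real.rpow_le_rpow_of_exponent_ge' hM₀ h1 hτ0.le hτle
  have hspow : (M₀ ^ (1 / (d : ℝ) ^ n)) ^ d ^ n = M₀ := by
    rw [← Real.rpow_natCast, ← Real.rpow_mul hM₀, Nat.cast_pow, one_div,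
      inv_mul_cancel₀ hdn.ne', Real.rpow_one]
  have h := hbound x hx M₁ hM₁ _ hs (fun i hi => hM₁x i (by rw [hJ1, hJ0]; exact hi))
    (fun i hi => by
      rw [finrank_euclideanSpace_fin, hspow]
      exact hM₀x i (by rw [hJ0]; exact hi))
  calc infDist x S ≤ C * (M₁ + M₀ ^ (1 / (d : ℝ) ^ n)) := h
    _ ≤ (C + 1) * (M₁ + M₀ ^ τ) := by gcongr; linarith
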